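/- Let X and Y be independent copies of a stationary process over a finite alphabet A with stationary measure μ satisfying hypothesis (A) with constants c, h, and suppose the process is α-mixing with rate α(·). For any k_n, g, n ∈ ℕ, the random variable S_n = Σ_{0≤i,j≤n−1} 1_{A_{i,j}}, with A_{i,j} = {f(σ^i X)_1^{k_n} = f(σ^j Y)_1^{k_n}}, satisfies var(S_n) ≤ 4(g+k_n)·E(S_n)^{3/2} + 4(g+k_n)²·E(S_n) + 2n⁴·α(g+k_n−k_n³) + 4n³(g+k_n)·α(g+k_n−k_n³) + (2n⁴ + 4n³(g+k_n))·c·e^{−h k_n²}. -/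

import Mathlib

open MeasureTheory Filter Topology

section RLEDefs

variable {A : Type*}

/-- The starting position of the run following the run that starts at position `i`:
the least index `> i` where the value of `x` changes (with the junk convention `i + 1`
if the sequence is constant from position `i` on). -/
noncomputable def nextChange (x : ℕ → A) (i : ℕ) : ℕ := by
  classical
  exact if h : ∃ j, x (i + j + 1) ≠ x i then i + Nat.find h + 1 else i + 1

/-- Starting position of the `n`-th maximal run of the sequence `x`. -/
noncomputable def runStart (x : ℕ → A) : ℕ → ℕ
  | 0 => 0
  | n + 1 => nextChange x (runStart x n)

/-- The run-length encoder `f : A^ℕ → (A × ℕ)^ℕ`: the `n`-th symbol of `f x` is the pair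
(value of the `n`-th maximal run of `x`, length of that run). -/
noncomputable def rle (x : ℕ → A) (n : ℕ) : A × ℕ :=
  (x (runStart x n), runStart x (n + 1) - runStart x n)

/-- `M_n(u,v)`: the length of the longest common substring of `u` and `v`
occurring within their first `n` symbols, i.e.
`max {k : u_i^{i+k-1} = v_j^{j+k-1} for some 0 ≤ i,j ≤ n-k}`. -/
noncomputable def matchLen {C : Type*} (u v : ℕ → C) (n : ℕ) : ℕ :=
  sSup {k | ∃ i j, i + k ≤ n ∧ j + k ≤ n ∧ ∀ m < k, u (i + m) = v (j + m)}

/-- `M^RLE_n(x,y) = M_n(f x, f y)`. -/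
noncomputable def MRLE (x y : ℕ → A) (n : ℕ) : ℕ := matchLen (rle x) (rle y) n

/-- `M̃_n(x,y) = max {k : f(σ^i x)_1^k = f(σ^j y)_1^k for some 0 ≤ i,j ≤ n-k}`. -/
noncomputable def Mtilde (x y : ℕ → A) (n : ℕ) : ℕ :=
  sSup {k | ∃ i j, i + k ≤ n ∧ j + k ≤ n ∧
    ∀ m < k, rle (fun t => x (t + i)) m = rle (fun t => y (t + j)) m}

/-- The number of maximal runs in the first `n` symbols of `x`, i.e. `|f(x_1^n)|`. -/
noncomputable def runCount (x : ℕ → A) (n : ℕ) : ℕ := by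
  classical
  exact ((Finset.range n).filter fun i => i = 0 ∨ x i ≠ x (i - 1)).card

/-- The left shift `σ` on sequences. -/
def shift (x : ℕ → A) : ℕ → A := fun n => x (n + 1)

variable [MeasurableSpace A]

/-- `Σ_{ω ∈ B^n} (f_*μ)(ω)²`: the sum, over all cylinders `ω` of length `n` in
`B^ℕ = (A × ℕ)^ℕ`, of the squared measure of `f⁻¹ω` (where `f` is the run-length
encoder), i.e. of the squared pushforward measure of the cylinder. -/
noncomputable def pushCylSum (μ : Measure (ℕ → A)) (n : ℕ) : ℝ :=
  ∑' ω : Fin n → A × ℕ, ((μ {x | ∀ i : Fin n, rle x i = ω i}).toReal) ^ 2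

/-- Lower Rényi entropy of order 2 of the pushforward measure `f_*μ`:
`H̲₂(f_*μ) = - liminf_n (1/n) log Σ_ω (f_*μ)(ω)²`. -/
noncomputable def H2lower (μ : Measure (ℕ → A)) : ℝ :=
  -liminf (fun n : ℕ => Real.log (pushCylSum μ n) / n) atTop

/-- Upper Rényi entropy of order 2 of the pushforward measure `f_*μ`:
`H̄₂(f_*μ) = - limsup_n (1/n) log Σ_ω (f_*μ)(ω)²`. -/
noncomputable def H2upper (μ : Measure (ℕ → A)) : ℝ :=
  -limsup (fun n : ℕ => Real.log (pushCylSum μ n) / n) atTop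

/-- Hypothesis (A): there are `c > 0`, `h > 0` with `μ(a…a) ≤ c e^{-hn}` for every
constant cylinder `a…a` of length `n`. -/
def HypA (μ : Measure (ℕ → A)) (c h : ℝ) : Prop :=
  0 < c ∧ 0 < h ∧
    ∀ (n : ℕ) (a : A), μ {x | ∀ i < n, x i = a} ≤ ENNReal.ofReal (c * Real.exp (-h * n))

/-- The σ-algebra `F_0^n` generated by the coordinates `X_0, …, X_n`. -/
def cylAlgLE (A : Type*) [MeasurableSpace A] (n : ℕ) : MeasurableSpace (ℕ → A) :=
  MeasurableSpace.comap (fun x (i : Fin (n + 1)) => x i) inferInstance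

/-- The σ-algebra `F_m^∞` generated by the coordinates `X_m, X_{m+1}, …`. -/
def cylAlgGE (A : Type*) [MeasurableSpace A] (m : ℕ) : MeasurableSpace (ℕ → A) :=
  MeasurableSpace.comap (fun x (i : ℕ) => x (m + i)) inferInstance

/-- α-mixing with rate function `a`: for all `n, g` and all `S ∈ F_0^n`, `T ∈ F_{n+g}^∞`,
`|μ(S ∩ T) - μ(S)μ(T)| ≤ a(g)`. -/
def AlphaMixingBound (μ : Measure (ℕ → A)) (a : ℕ → ℝ) : Prop :=
  ∀ (n g : ℕ) (S T : Set (ℕ → A)),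
    MeasurableSet[cylAlgLE A n] S → MeasurableSet[cylAlgGE A (n + g)] T →
    |(μ (S ∩ T)).toReal - (μ S).toReal * (μ T).toReal| ≤ a g

/-- α-mixing with exponential decay. -/
def AlphaMixingExp (μ : Measure (ℕ → A)) : Prop :=
  ∃ C θ : ℝ, 0 < C ∧ 0 < θ ∧ AlphaMixingBound μ fun g => C * Real.exp (-θ * g)

/-- ψ-mixing with polynomial rate `ψ(g) = g^{-a}`: for all `n` and `g ≥ 1` and all
`S ∈ F_0^n`, `T ∈ F_{n+g}^∞`, `|μ(S ∩ T) - μ(S)μ(T)| ≤ g^{-a} μ(S) μ(T)`. -/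
def PsiMixingPoly (μ : Measure (ℕ → A)) (a : ℝ) : Prop :=
  ∀ (n g : ℕ), 1 ≤ g → ∀ (S T : Set (ℕ → A)),
    MeasurableSet[cylAlgLE A n] S → MeasurableSet[cylAlgGE A (n + g)] T →
    |(μ (S ∩ T)).toReal - (μ S).toReal * (μ T).toReal| ≤
      (g : ℝ) ^ (-a) * (μ S).toReal * (μ T).toReal

/-- `S_n = Σ_{0 ≤ i,j ≤ n-1} 1_{A_{i,j}}` with `A_{i,j} = {f(σ^i X)_1^k = f(σ^j Y)_1^k}`,
seen as a random variable on the product space (X = first coordinate, Y = second). -/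
noncomputable def Sn (k n : ℕ) (p : (ℕ → A) × (ℕ → A)) : ℝ := by
  classical
  exact ∑ i ∈ Finset.range n, ∑ j ∈ Finset.range n,
    if ∀ m < k, rle (fun t => p.1 (t + i)) m = rle (fun t => p.2 (t + j)) m then (1 : ℝ) else 0

end RLEDefs

section Aux

set_option linter.unusedSectionVars false

variable {A : Type*}

/-- Not eventually constant. -/
def GoodSeq (x : ℕ → A) : Prop := ∀ s, ∃ d, x (s + d + 1) ≠ x s

/-- iterated shift -/
def shf (i : ℕ) (x : ℕ → A) : ℕ → A := fun t => x (t + i)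

/-- first k symbols of the encoding -/
noncomputable def Zk (k : ℕ) (x : ℕ → A) : Fin k → A × ℕ := fun m => rle x m

lemma good_shf {x : ℕ → A} (hx : GoodSeq x) (i : ℕ) : GoodSeq (shf i x) := by
  intro s
  obtain ⟨d, hd⟩ := hx (s + i)
  refine ⟨d, ?_⟩
  simp only [shf]
  rwa [show s + d + 1 + i = s + i + d + 1 by ring]

lemma nextChange_gt (x : ℕ → A) (s : ℕ) : s < nextChange x s := by
  unfold nextChange
  split_ifs <;> omega

lemma nextChange_good {x : ℕ → A} {s : ℕ} (hx : ∃ d, x (s + d + 1) ≠ x s) :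
    (∀ t, s ≤ t → t < nextChange x s → x t = x s) ∧ x (nextChange x s) ≠ x s := by
  classical
  have e : nextChange x s = s + Nat.find hx + 1 := by
    unfold nextChange
    rw [dif_pos hx]
  rw [e]
  refine ⟨?_, Nat.find_spec hx⟩
  intro t h1 h2
  rcases Nat.eq_or_lt_of_le h1 with h | h
  · rw [h]
  · have := Nat.find_min hx (m := t - s - 1) (by omega)
    rw [show s + (t - s - 1) + 1 = t by omega] at this
    simpa using this

lemma nextChange_unique {x : ℕ → A} {s e : ℕ} (h1 : s < e)
    (h2 : ∀ t, s ≤ t → t < e → x t = x s) (h3 : x e ≠ x s) : nextChange x s = e := by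
  have hx : ∃ d, x (s + d + 1) ≠ x s :=
    ⟨e - s - 1, by rwa [show s + (e - s - 1) + 1 = e by omega]⟩
  obtain ⟨h4, h5⟩ := nextChange_good hx
  have h6 := nextChange_gt x s
  rcases lt_trichotomy (nextChange x s) e with h | h | h
  · exact absurd (h2 _ h6.le h) h5
  · exact h
  · exact absurd (h4 _ h1.le h) h3

lemma runStart_succ (x : ℕ → A) (m : ℕ) : runStart x (m + 1) = nextChange x (runStart x m) := rfl

lemma runStart_lt (x : ℕ → A) (m : ℕ) : runStart x m < runStart x (m + 1) := nextChange_gt _ _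

lemma runStart_det {x y : ℕ → A} (hx : GoodSeq x) {K : ℕ}
    (hxy : ∀ t ≤ K, x t = y t) : ∀ m, runStart x m ≤ K → runStart y m = runStart x m := by
  intro m
  induction m with
  | zero => intro _; rfl
  | succ m ih =>
    intro hm
    have hlt := runStart_lt x m
    have e := ih (by omega)
    obtain ⟨h1, h2⟩ := nextChange_good (hx (runStart x m))
    rw [runStart_succ y, e]
    rw [← runStart_succ] at h1 h2
    apply nextChange_unique hlt
    · intro t ht1 ht2
      rw [← hxy t (by omega), ← hxy _ (by omega)]
      exact h1 t ht1 ht2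
    · rw [← hxy _ hm, ← hxy _ (by omega)]
      exact h2

lemma Zk_det {x y : ℕ → A} (hx : GoodSeq x) {K k : ℕ}
    (hxy : ∀ t ≤ K, x t = y t) (hk : runStart x k ≤ K) : Zk k y = Zk k x := by
  have hmono : StrictMono (runStart x) := strictMono_nat_of_lt_succ (runStart_lt x)
  funext m
  have h1 := hmono m.2
  have h2 : runStart x (m + 1) ≤ runStart x k := hmono.monotone m.2
  simp only [Zk, rle]
  rw [runStart_det hx hxy m (by omega), runStart_det hx hxy (m + 1) (by omega),
    hxy _ (by omega)]

lemma runStart_of_Zk {x y : ℕ → A} {k : ℕ} (h : Zk k x = Zk k y) :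
    ∀ m ≤ k, runStart x m = runStart y m := by
  intro m
  induction m with
  | zero => intro _; rfl
  | succ m ih =>
    intro hm
    have e := ih (by omega)
    have := congrFun h ⟨m, hm⟩
    simp only [Zk, rle, Prod.mk.injEq] at this
    have h1 := runStart_lt x m
    have h2 := runStart_lt y m
    omega

lemma runStart_le_short {x : ℕ → A} {k L : ℕ} (h : ∀ m : Fin k, (Zk k x m).2 ≤ L) :
    ∀ m ≤ k, runStart x m ≤ m * L := by
  intro m
  induction m with
  | zero => intro _; simp [runStart]
  | succ m ih =>
    intro hm
    have e := ih (by omega)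
    have := h ⟨m, hm⟩
    simp only [Zk, rle] at this
    rw [Nat.succ_mul]
    omega

section Meas
variable [Fintype A] [MeasurableSpace A] [MeasurableSingletonClass A]

lemma meas_shf (i : ℕ) : Measurable (shf (A := A) i) := by
  unfold shf
  exact measurable_pi_lambda _ fun t => measurable_pi_apply _

lemma meas_eq (i j : ℕ) : MeasurableSet {x : ℕ → A | x i = x j} :=
  measurableSet_eq_fun (measurable_pi_apply i) (measurable_pi_apply j)

lemma meas_nextChange (i : ℕ) : Measurable (fun x : ℕ → A => nextChange x i) := by
  refine measurable_to_countable' fun e => ?_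
  have : (fun x : ℕ → A => nextChange x i) ⁻¹' {e} =
      ({x | ∀ j, x (i + j + 1) = x i} ∩ {x | e = i + 1}) ∪
      ({x | i < e} ∩ {x | ∀ t, i ≤ t → t < e → x t = x i} ∩ {x | x e = x i}ᶜ) := by
    ext x
    simp only [Set.mem_preimage, Set.mem_singleton_iff, Set.mem_union, Set.mem_inter_iff,
      Set.mem_ofPred_eq, Set.mem_compl_iff]
    constructor
    · intro h
      by_cases hx : ∃ d, x (i + d + 1) ≠ x i
      · right
        have := nextChange_good hx
        rw [h] at this
        exact ⟨⟨h ▸ nextChange_gt x i, this.1⟩, this.2⟩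
      · left
        refine ⟨by simpa using hx, ?_⟩
        rw [← h]
        unfold nextChange
        rw [dif_neg hx]
    · rintro (⟨h1, h2⟩ | ⟨⟨h1, h2⟩, h3⟩)
      · unfold nextChange
        rw [dif_neg (by simpa using h1), h2]
      · exact nextChange_unique h1 h2 h3
  rw [this]
  refine MeasurableSet.union (MeasurableSet.inter ?_ (MeasurableSet.const _))
    (((MeasurableSet.const _).inter ?_).inter (meas_eq _ _).compl)
  · rw [Set.ofPred_forall]
    exact MeasurableSet.iInter fun j => meas_eq _ _
  · simp only [Set.ofPred_forall]
    exact MeasurableSet.iInter fun t => MeasurableSet.iInter fun _ =>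
      MeasurableSet.iInter fun _ => meas_eq _ _

lemma meas_comp_nat {C : Type*} [MeasurableSpace C] {F : (ℕ → A) → ℕ → C} {r : (ℕ → A) → ℕ}
    (hF : ∀ i, Measurable (fun x => F x i)) (hr : Measurable r) :
    Measurable (fun x => F x (r x)) := by
  have : Measurable (fun p : (ℕ → A) × ℕ => F p.1 p.2) :=
    measurable_from_prod_countable_left hF
  exact this.comp (measurable_id.prodMk hr)

lemma meas_runStart (m : ℕ) : Measurable (fun x : ℕ → A => runStart x m) := by
  induction m with
  | zero => exact measurable_const
  | succ m ih => exact meas_comp_nat (F := fun x i => nextChange x i) meas_nextChange ih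

lemma meas_Zk (k : ℕ) : Measurable (Zk (A := A) k) := by
  refine measurable_pi_lambda _ fun m => ?_
  unfold Zk rle
  exact (meas_comp_nat (fun i => measurable_pi_apply i) (meas_runStart m)).prodMk
    ((meas_runStart _).sub (meas_runStart _))

variable {μ : Measure (ℕ → A)} [IsProbabilityMeasure μ]

lemma mp_shf (hinv : MeasurePreserving (shift (A := A)) μ μ) (i : ℕ) :
    MeasurePreserving (shf (A := A) i) μ μ := by
  induction i with
  | zero => exact MeasurePreserving.id μ
  | succ i ih =>
    have := ih.comp hinv
    have e : shf (A := A) (i + 1) = shf i ∘ shift := by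
      funext x t
      simp only [shf, shift, Function.comp]
      congr 1
    rw [e]
    exact this

lemma ae_good (hinv : MeasurePreserving (shift (A := A)) μ μ) {c h : ℝ} (hA : HypA μ c h) :
    ∀ᵐ x ∂μ, GoodSeq x := by
  obtain ⟨hc, hh, hb⟩ := hA
  have h0 : ∀ a : A, μ {x | ∀ i, x i = a} = 0 := by
    intro a
    have hle : ∀ n : ℕ, μ {x | ∀ i, x i = a} ≤ ENNReal.ofReal (c * Real.exp (-h * n)) :=
      fun n => (measure_mono (by intro x hx i _; exact hx i)).trans (hb n a)
    have ht : Tendsto (fun n : ℕ => ENNReal.ofReal (c * Real.exp (-h * n))) atTop (𝓝 0) := by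
      rw [← ENNReal.ofReal_zero]
      refine ENNReal.tendsto_ofReal ?_
      rw [← mul_zero c]
      refine Tendsto.const_mul c (Real.tendsto_exp_atBot.comp ?_)
      exact tendsto_natCast_atTop_atTop.const_mul_atTop_of_neg (by linarith)
    exact le_antisymm (ge_of_tendsto' ht hle) zero_le
  have h1 : ∀ᵐ x ∂μ, ∀ a : A, ¬ ∀ i, x i = a := by
    rw [ae_all_iff]
    intro a
    rw [ae_iff]
    simpa using h0 a
  have h2 : ∀ᵐ x ∂μ, ∀ s, ∀ a : A, ¬ ∀ i, shf s x i = a := by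
    rw [ae_all_iff]
    intro s
    exact (mp_shf hinv s).quasiMeasurePreserving.ae h1
  filter_upwards [h2] with x hx s
  by_contra hcon
  push Not at hcon
  refine hx s (x s) fun i => ?_
  simp only [shf]
  rcases i with _ | i
  · simp
  · rw [← hcon i]
    congr 1
    ring

/-- law of the block -/
noncomputable def pk (μ : Measure (ℕ → A)) (k : ℕ) (w : Fin k → A × ℕ) : ENNReal :=
  μ (Zk k ⁻¹' {w})

lemma pk_shf (hinv : MeasurePreserving (shift (A := A)) μ μ) (k i : ℕ) (w : Fin k → A × ℕ) :
    μ {x | Zk k (shf i x) = w} = pk μ k w := by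
  have := (mp_shf hinv i).measure_preimage
    ((meas_Zk k (measurableSet_singleton w)).nullMeasurableSet)
  exact this

lemma long_bound (hinv : MeasurePreserving (shift (A := A)) μ μ) {c h : ℝ} (hA : HypA μ c h)
    (k : ℕ) (w : Fin k → A × ℕ) (m : Fin k) (hm : k ^ 2 < (w m).2) :
    pk μ k w ≤ ENNReal.ofReal (c * Real.exp (-h * (k : ℝ) ^ 2)) := by
  by_cases hne : ∃ x0 : ℕ → A, Zk k x0 = w
  swap
  · have : pk μ k w = 0 := by
      unfold pk
      have : Zk k ⁻¹' {w} = (∅ : Set (ℕ → A)) := by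
        ext x
        simp only [Set.mem_preimage, Set.mem_singleton_iff, Set.mem_empty_iff_false, iff_false]
        exact fun hx => hne ⟨x, hx⟩
      rw [this, measure_empty]
    rw [this]
    exact zero_le
  obtain ⟨x0, hx0⟩ := hne
  set s := runStart x0 m
  have hms : MeasurableSet {x : ℕ → A | ∀ i < k ^ 2, x i = (w m).1} := by
    simp only [Set.ofPred_forall]
    exact MeasurableSet.iInter fun t => MeasurableSet.iInter fun _ =>
      measurable_pi_apply t (measurableSet_singleton _)
  calc pk μ k w ≤ μ (shf s ⁻¹' {x | ∀ i < k ^ 2, x i = (w m).1}) := by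
        apply measure_mono_ae
        filter_upwards [ae_good hinv hA] with x hx hxw
        have hxw : Zk k x = w := hxw
        have e := runStart_of_Zk (hxw.trans hx0.symm) m m.2.le
        intro i hi
        have hm' := congrFun hxw m
        simp only [Zk, rle] at hm'
        have h1 := congrArg Prod.fst hm'
        have h2 := congrArg Prod.snd hm'
        simp only at h1 h2
        simp only [shf]
        rw [← h1]
        refine (nextChange_good (hx (runStart x m))).1 _ (by omega) ?_
        rw [← runStart_succ]
        omega
    _ = μ {x | ∀ i < k ^ 2, x i = (w m).1} :=
        (mp_shf hinv s).measure_preimage hms.nullMeasurableSet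
    _ ≤ _ := by
        have := hA.2.2 (k ^ 2) (w m).1
        push_cast at this
        exact this

lemma short_bound (hinv : MeasurePreserving (shift (A := A)) μ μ) {c h : ℝ} (hA : HypA μ c h)
    {a : ℕ → ℝ} (ha : Antitone a) (hmix : AlphaMixingBound μ a)
    (k N i i' : ℕ) (hN : k ^ 3 ≤ N) (hi : i + N ≤ i') (w w' : Fin k → A × ℕ)
    (hw : ∀ m, (w m).2 ≤ k ^ 2) :
    μ {x | Zk k (shf i x) = w ∧ Zk k (shf i' x) = w'} ≤
      pk μ k w * pk μ k w' + ENNReal.ofReal (a (N - k ^ 3)) := by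
  set E : Set (ℕ → A) := {x | Zk k (shf i x) = w} with hE
  set T : Set (ℕ → A) := {x | Zk k (shf i' x) = w'} with hT
  set S : Set (ℕ → A) := {x | ∃ y, GoodSeq y ∧ Zk k y = w ∧ ∀ t ≤ k ^ 3, y t = shf i x t} with hS
  have hES : E =ᵐ[μ] S := by
    filter_upwards [ae_good hinv hA] with x hx
    apply propext
    constructor
    · intro hxE
      exact ⟨shf i x, good_shf hx i, hxE, fun _ _ => rfl⟩
    · rintro ⟨y, hy, hyw, hyx⟩
      have hb := runStart_le_short (x := y) (L := k ^ 2) (by rw [hyw]; exact hw) k le_rfl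
      have := Zk_det hy hyx (k := k) (by rw [pow_succ']; exact hb)
      exact this.trans hyw
  have hSm : MeasurableSet[cylAlgLE A (i + k ^ 3)] S := by
    refine ⟨{z | ∃ y, GoodSeq y ∧ Zk k y = w ∧
      ∀ t, ∀ ht : t ≤ k ^ 3, y t = z ⟨t + i, by omega⟩}, ?_, ?_⟩
    · exact Set.Finite.measurableSet (Set.toFinite _)
    · ext x
      rfl
  have hTm : MeasurableSet[cylAlgGE A (i + k ^ 3 + (i' - (i + k ^ 3)))] T := by
    rw [show i + k ^ 3 + (i' - (i + k ^ 3)) = i' by omega]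
    refine ⟨Zk k ⁻¹' {w'}, meas_Zk k (measurableSet_singleton w'), ?_⟩
    ext x
    have e : shf i' x = fun t => x (i' + t) := by
      funext t
      simp only [shf, add_comm]
    simp only [hT, e, Set.mem_preimage, Set.mem_singleton_iff, Set.mem_ofPred_eq]
  have key := hmix (i + k ^ 3) (i' - (i + k ^ 3)) S T hSm hTm
  have hant : a (i' - (i + k ^ 3)) ≤ a (N - k ^ 3) := ha (by omega)
  have e1 : μ (S ∩ T) = μ {x | Zk k (shf i x) = w ∧ Zk k (shf i' x) = w'} :=
    (measure_congr (hES.inter (ae_eq_refl T))).symm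
  have e2 : μ S = pk μ k w := by rw [← measure_congr hES]; exact pk_shf hinv k i w
  have e3 : μ T = pk μ k w' := pk_shf hinv k i' w'
  rw [← e1, ← e2, ← e3]
  have h0 : 0 ≤ a (N - k ^ 3) := (abs_nonneg _).trans (key.trans hant)
  rw [← ENNReal.ofReal_toReal (measure_ne_top μ (S ∩ T)),
    ← ENNReal.ofReal_toReal (measure_ne_top μ S),
    ← ENNReal.ofReal_toReal (measure_ne_top μ T), ← ENNReal.ofReal_mul ENNReal.toReal_nonneg,
    ← ENNReal.ofReal_add (by positivity) h0]
  apply ENNReal.ofReal_le_ofReal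
  have := (abs_le.1 (key.trans hant)).2
  linarith

lemma a_nonneg {a : ℕ → ℝ} (hmix : AlphaMixingBound μ a) (m : ℕ) : 0 ≤ a m :=
  (abs_nonneg _).trans (hmix 0 m ∅ ∅ (@MeasurableSet.empty _ (cylAlgLE A 0)) (@MeasurableSet.empty _ (cylAlgGE A (0 + m))))

/-- joint law -/
noncomputable def qk (μ : Measure (ℕ → A)) (k i i' : ℕ)
    (w : (Fin k → A × ℕ) × (Fin k → A × ℕ)) : ENNReal :=
  μ {x | Zk k (shf i x) = w.1 ∧ Zk k (shf i' x) = w.2}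

lemma qk_le_aux (hinv : MeasurePreserving (shift (A := A)) μ μ) {c h : ℝ} (hA : HypA μ c h)
    {a : ℕ → ℝ} (ha : Antitone a) (hmix : AlphaMixingBound μ a)
    (k N i i' : ℕ) (hN : k ^ 3 ≤ N) (hi : i + N ≤ i') (w w' : Fin k → A × ℕ) :
    μ {x | Zk k (shf i x) = w ∧ Zk k (shf i' x) = w'} ≤ pk μ k w * pk μ k w' +
      ENNReal.ofReal (a (N - k ^ 3) + c * Real.exp (-h * (k : ℝ) ^ 2)) := by
  have h0 := a_nonneg hmix (N - k ^ 3)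
  have h1 : 0 ≤ c * Real.exp (-h * (k : ℝ) ^ 2) := mul_nonneg hA.1.le (Real.exp_pos _).le
  by_cases hw : ∀ m, (w m).2 ≤ k ^ 2
  · refine (short_bound hinv hA ha hmix k N i i' hN hi w w' hw).trans ?_
    gcongr
    linarith
  · push Not at hw
    obtain ⟨m, hm⟩ := hw
    calc _ ≤ μ {x | Zk k (shf i x) = w} := measure_mono fun x hx => hx.1
      _ = pk μ k w := pk_shf hinv k i w
      _ ≤ _ := long_bound hinv hA k w m hm
      _ ≤ ENNReal.ofReal (a (N - k ^ 3) + c * Real.exp (-h * (k : ℝ) ^ 2)) :=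
          ENNReal.ofReal_le_ofReal (by linarith)
      _ ≤ _ := le_add_self

lemma qk_le (hinv : MeasurePreserving (shift (A := A)) μ μ) {c h : ℝ} (hA : HypA μ c h)
    {a : ℕ → ℝ} (ha : Antitone a) (hmix : AlphaMixingBound μ a)
    (k N i i' : ℕ) (hN : k ^ 3 ≤ N) (hi : i + N ≤ i' ∨ i' + N ≤ i) (w) :
    qk μ k i i' w ≤ pk μ k w.1 * pk μ k w.2 +
      ENNReal.ofReal (a (N - k ^ 3) + c * Real.exp (-h * (k : ℝ) ^ 2)) := by
  rcases hi with hi | hi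
  · exact qk_le_aux hinv hA ha hmix k N i i' hN hi _ _
  · have := qk_le_aux hinv hA ha hmix k N i' i hN hi w.2 w.1
    rw [mul_comm (pk μ k w.1)]
    refine le_trans (le_of_eq ?_) this
    unfold qk
    congr 1
    ext x
    exact and_comm

lemma prod_match {X W : Type*} [MeasurableSpace X] [MeasurableSpace W] [Countable W]
    [MeasurableSingletonClass W] (ν : Measure X) [IsProbabilityMeasure ν] {F G : X → W}
    (hF : Measurable F) (hG : Measurable G) :
    (ν.prod ν) {p | F p.1 = G p.2} = ∑' w, ν (F ⁻¹' {w}) * ν (G ⁻¹' {w}) := by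
  have e : {p : X × X | F p.1 = G p.2} = ⋃ w, (F ⁻¹' {w}) ×ˢ (G ⁻¹' {w}) := by
    ext p
    simp [eq_comm]
  rw [e, measure_iUnion]
  · simp_rw [Measure.prod_prod]
  · intro w w' hww
    rw [Function.onFun, Set.disjoint_left]
    rintro p ⟨h1, -⟩ ⟨h2, -⟩
    exact hww (h1.symm.trans h2)
  · exact fun w => (hF (measurableSet_singleton w)).prod (hG (measurableSet_singleton w))

lemma sum_fibres {X W : Type*} [MeasurableSpace X] [MeasurableSpace W] [Countable W]
    [MeasurableSingletonClass W] (ν : Measure X) {F : X → W}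
    (hF : Measurable F) (B : Set X) (hB : MeasurableSet B) :
    ∑' w, ν (B ∩ F ⁻¹' {w}) = ν B := by
  have e : B = ⋃ w, B ∩ F ⁻¹' {w} := by
    ext p
    simp
  conv_rhs => rw [e]
  rw [measure_iUnion]
  · intro w w' hww
    rw [Function.onFun, Set.disjoint_left]
    rintro p ⟨-, h1⟩ ⟨-, h2⟩
    exact hww (h1.symm.trans h2)
  · exact fun w => hB.inter (hF (measurableSet_singleton w))

lemma meas_Zs (k i : ℕ) : Measurable (fun x : ℕ → A => Zk k (shf i x)) :=
  (meas_Zk k).comp (meas_shf i)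

lemma qk_eq (k i i' : ℕ) (w) : qk μ k i i' w =
    μ ((fun x => (Zk k (shf i x), Zk k (shf i' x))) ⁻¹' {w}) := by
  unfold qk
  congr 1
  ext x
  simp [Prod.ext_iff]

lemma qk_sum (k i i' : ℕ) : ∑' w, qk μ k i i' w = 1 := by
  have := sum_fibres μ ((meas_Zs (A := A) k i).prodMk (meas_Zs k i')) Set.univ MeasurableSet.univ
  simp only [Set.univ_inter, measure_univ] at this
  simp_rw [qk_eq]
  exact this

lemma pk_sum (k : ℕ) : ∑' w, pk μ k w = 1 := by
  have := sum_fibres μ (meas_Zk (A := A) k) Set.univ MeasurableSet.univ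
  simp only [Set.univ_inter, measure_univ] at this
  exact this

lemma qk_marg1 (hinv : MeasurePreserving (shift (A := A)) μ μ) (k i i' : ℕ) (w) :
    ∑' w', qk μ k i i' (w, w') = pk μ k w := by
  rw [← pk_shf hinv k i w]
  exact sum_fibres μ (meas_Zs (A := A) k i') {x | Zk k (shf i x) = w}
    (meas_Zs k i (measurableSet_singleton w))

lemma qk_marg2 (hinv : MeasurePreserving (shift (A := A)) μ μ) (k i i' : ℕ) (w') :
    ∑' w, qk μ k i i' (w, w') = pk μ k w' := by
  rw [← pk_shf hinv k i' w']
  rw [← sum_fibres μ (meas_Zs (A := A) k i) {x | Zk k (shf i' x) = w'}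
    (meas_Zs k i' (measurableSet_singleton w'))]
  refine tsum_congr fun w => ?_
  unfold qk
  congr 1
  ext x
  exact and_comm

/-- collision probability -/
noncomputable def P2 (μ : Measure (ℕ → A)) (k : ℕ) : ENNReal := ∑' w, pk μ k w ^ 2

/-- the matching event -/
def Aev (k : ℕ) (r : ℕ × ℕ) : Set ((ℕ → A) × (ℕ → A)) :=
  {p | Zk k (shf r.1 p.1) = Zk k (shf r.2 p.2)}

lemma meas_Aev (k : ℕ) (r : ℕ × ℕ) : MeasurableSet (Aev (A := A) k r) :=
  measurableSet_eq_fun ((meas_Zs k r.1).comp measurable_fst) ((meas_Zs k r.2).comp measurable_snd)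

lemma prob_Aev (hinv : MeasurePreserving (shift (A := A)) μ μ) (k : ℕ) (r : ℕ × ℕ) :
    (μ.prod μ) (Aev k r) = P2 μ k := by
  unfold Aev P2
  rw [prod_match μ (F := fun x => Zk k (shf r.1 x)) (G := fun x => Zk k (shf r.2 x))
    (meas_Zs k r.1) (meas_Zs k r.2)]
  refine tsum_congr fun w => ?_
  rw [sq, ← pk_shf hinv k r.1 w]
  congr 1
  rw [pk_shf hinv k r.1 w]
  exact pk_shf hinv k r.2 w

lemma prob_Aev2 (k : ℕ) (r r' : ℕ × ℕ) :
    (μ.prod μ) (Aev k r ∩ Aev k r') =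
      ∑' w, qk μ k r.1 r'.1 w * qk μ k r.2 r'.2 w := by
  have := prod_match μ (F := fun x : ℕ → A => (Zk k (shf r.1 x), Zk k (shf r'.1 x)))
    (G := fun x => (Zk k (shf r.2 x), Zk k (shf r'.2 x)))
    ((meas_Zs k _).prodMk (meas_Zs k _)) ((meas_Zs k _).prodMk (meas_Zs k _))
  simp_rw [qk_eq]
  rw [← this]
  congr 1
  ext p
  simp [Aev, Prod.ext_iff]

lemma P2_le_one (hinv : MeasurePreserving (shift (A := A)) μ μ) (k : ℕ) : P2 μ k ≤ 1 := by
  rw [← prob_Aev hinv k (0, 0)]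
  exact prob_le_one

lemma pp_sum (k : ℕ) : ∑' w : (Fin k → A × ℕ) × (Fin k → A × ℕ), pk μ k w.1 * pk μ k w.2 = 1 := by
  rw [ENNReal.tsum_prod']
  simp_rw [ENNReal.tsum_mul_left, pk_sum, mul_one]
  exact pk_sum k

lemma pp2_sum (k : ℕ) : ∑' w : (Fin k → A × ℕ) × (Fin k → A × ℕ),
    (pk μ k w.1 * pk μ k w.2) * (pk μ k w.1 * pk μ k w.2) = P2 μ k * P2 μ k := by
  rw [ENNReal.tsum_prod']
  have : ∀ w w' : Fin k → A × ℕ, (pk μ k w * pk μ k w') * (pk μ k w * pk μ k w') =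
      pk μ k w ^ 2 * pk μ k w' ^ 2 := by intros; ring
  simp_rw [this, ENNReal.tsum_mul_left, ENNReal.tsum_mul_right]
  rfl

lemma far_far {k i i' j j' : ℕ} {ε : ENNReal}
    (h1 : ∀ w, qk μ k i i' w ≤ pk μ k w.1 * pk μ k w.2 + ε)
    (h2 : ∀ w, qk μ k j j' w ≤ pk μ k w.1 * pk μ k w.2 + ε) :
    ∑' w, qk μ k i i' w * qk μ k j j' w ≤ P2 μ k * P2 μ k + 2 * ε := by
  calc _ ≤ ∑' w : (Fin k → A × ℕ) × (Fin k → A × ℕ),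
        ((pk μ k w.1 * pk μ k w.2) * (pk μ k w.1 * pk μ k w.2)
          + ε * (pk μ k w.1 * pk μ k w.2) + qk μ k i i' w * ε) := by
        refine ENNReal.tsum_le_tsum fun w => ?_
        calc _ ≤ qk μ k i i' w * (pk μ k w.1 * pk μ k w.2 + ε) := by gcongr; exact h2 w
          _ = qk μ k i i' w * (pk μ k w.1 * pk μ k w.2) + qk μ k i i' w * ε := by ring
          _ ≤ (pk μ k w.1 * pk μ k w.2 + ε) * (pk μ k w.1 * pk μ k w.2) + qk μ k i i' w * ε := by
            gcongr; exact h1 w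
          _ = _ := by ring
    _ = _ := by
        rw [ENNReal.tsum_add, ENNReal.tsum_add, pp2_sum, ENNReal.tsum_mul_left,
          ENNReal.tsum_mul_right, pp_sum, qk_sum]
        ring

lemma pk_cube (k : ℕ) : ∑' w, pk μ k w ^ 3 ≤ P2 μ k ^ (3 / 2 : ℝ) := by
  have h : ∀ w, pk μ k w ≤ P2 μ k ^ (1 / 2 : ℝ) := by
    intro w
    have h1 : pk μ k w ^ 2 ≤ P2 μ k := ENNReal.le_tsum w
    calc pk μ k w = (pk μ k w ^ 2) ^ (1 / 2 : ℝ) := by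
          rw [← ENNReal.rpow_natCast, ← ENNReal.rpow_mul]
          norm_num
      _ ≤ _ := ENNReal.rpow_le_rpow h1 (by norm_num)
  calc ∑' w, pk μ k w ^ 3 ≤ ∑' w, pk μ k w ^ 2 * P2 μ k ^ (1 / 2 : ℝ) := by
        refine ENNReal.tsum_le_tsum fun w => ?_
        rw [pow_succ]
        gcongr
        exact h w
    _ = P2 μ k * P2 μ k ^ (1 / 2 : ℝ) := by rw [ENNReal.tsum_mul_right]; rfl
    _ = P2 μ k ^ (1 : ℝ) * P2 μ k ^ (1 / 2 : ℝ) := by rw [ENNReal.rpow_one]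
    _ = _ := by
        rw [← ENNReal.rpow_add_of_nonneg _ _ (by norm_num) (by norm_num)]
        norm_num

lemma two_mul_le_sq (x y : ENNReal) : 2 * (x * y) ≤ x ^ 2 + y ^ 2 := by
  rcases le_total x y with h | h
  · obtain ⟨d, rfl⟩ := exists_add_of_le h
    calc 2 * (x * (x + d)) ≤ 2 * (x * (x + d)) + d ^ 2 := le_self_add
      _ = _ := by ring
  · obtain ⟨d, rfl⟩ := exists_add_of_le h
    calc 2 * ((y + d) * y) ≤ 2 * ((y + d) * y) + d ^ 2 := le_self_add
      _ = _ := by ring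

lemma close_far (hinv : MeasurePreserving (shift (A := A)) μ μ) {k i i' j j' : ℕ} {ε : ENNReal}
    (h2 : ∀ w, qk μ k j j' w ≤ pk μ k w.1 * pk μ k w.2 + ε) :
    ∑' w, qk μ k i i' w * qk μ k j j' w ≤ P2 μ k ^ (3 / 2 : ℝ) + ε := by
  have hs1 : ∑' w, qk μ k i i' w * pk μ k w.1 ^ 2 = ∑' w, pk μ k w ^ 3 := by
    rw [ENNReal.tsum_prod']
    refine tsum_congr fun w => ?_
    simp only
    rw [ENNReal.tsum_mul_right, qk_marg1 hinv]
    ring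
  have hs2 : ∑' w, qk μ k i i' w * pk μ k w.2 ^ 2 = ∑' w, pk μ k w ^ 3 := by
    rw [ENNReal.tsum_prod', ENNReal.tsum_comm]
    refine tsum_congr fun w => ?_
    simp only
    rw [ENNReal.tsum_mul_right, qk_marg2 hinv]
    ring
  have key : ∑' w, qk μ k i i' w * (pk μ k w.1 * pk μ k w.2) ≤ ∑' w, pk μ k w ^ 3 := by
    have : 2 * ∑' w, qk μ k i i' w * (pk μ k w.1 * pk μ k w.2) ≤ 2 * ∑' w, pk μ k w ^ 3 := by
      rw [← ENNReal.tsum_mul_left, two_mul (∑' w, pk μ k w ^ 3)]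
      conv_rhs =>
        congr
        · rw [← hs1]
        · rw [← hs2]
      rw [← ENNReal.tsum_add]
      refine ENNReal.tsum_le_tsum fun w => ?_
      rw [← mul_add, mul_left_comm]
      gcongr
      exact two_mul_le_sq _ _
    exact (ENNReal.mul_le_mul_iff_right (by norm_num) (by norm_num)).1 this
  calc _ ≤ ∑' w, (qk μ k i i' w * (pk μ k w.1 * pk μ k w.2) + qk μ k i i' w * ε) := by
        refine ENNReal.tsum_le_tsum fun w => ?_
        rw [← mul_add]
        gcongr
        exact h2 w
    _ ≤ _ := by
        rw [ENNReal.tsum_add, ENNReal.tsum_mul_right, qk_sum, one_mul]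
        gcongr
        exact key.trans (pk_cube k)

lemma pk_small (hinv : MeasurePreserving (shift (A := A)) μ μ) {c h : ℝ} (hA : HypA μ c h)
    {a : ℕ → ℝ} (hmix : AlphaMixingBound μ a) {k : ℕ} (hk : 2 ≤ k) (w : Fin k → A × ℕ) :
    (pk μ k w).toReal ≤ 1 / 2 ∧ (pk μ k w).toReal - (pk μ k w).toReal ^ 2 ≤ a 0 := by
  by_cases hne : ∃ x0 : ℕ → A, GoodSeq x0 ∧ Zk k x0 = w
  swap
  · have : pk μ k w = 0 := by
      unfold pk
      rw [measure_eq_zero_iff_ae_notMem]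
      filter_upwards [ae_good hinv hA] with x hx hxw
      exact hne ⟨x, hx, hxw⟩
    rw [this]
    have := a_nonneg hmix 0
    simpa using this
  obtain ⟨x0, hg, hx0⟩ := hne
  set l := runStart x0 1 with hl
  have hab : x0 l ≠ x0 0 := (nextChange_good (hg 0)).2
  have hms : ∀ b : A, MeasurableSet {x : ℕ → A | x 0 = b} := fun b =>
    measurable_pi_apply (X := fun _ : ℕ => A) 0 (measurableSet_singleton b)
  have hq : ∀ b : A, (μ {x : ℕ → A | x 0 = b}).toReal
      - (μ {x : ℕ → A | x 0 = b}).toReal * (μ {x : ℕ → A | x 0 = b}).toReal ≤ a 0 := by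
    intro b
    have h1 : MeasurableSet[cylAlgLE A 0] {x : ℕ → A | x 0 = b} :=
      ⟨{z | z 0 = b}, measurable_pi_apply (X := fun _ : Fin (0 + 1) => A) 0 (measurableSet_singleton b), rfl⟩
    have h2 : MeasurableSet[cylAlgGE A (0 + 0)] {x : ℕ → A | x 0 = b} :=
      ⟨{z | z 0 = b}, measurable_pi_apply (X := fun _ : ℕ => A) 0 (measurableSet_singleton b), rfl⟩
    have := hmix 0 0 _ _ h1 h2
    rw [Set.inter_self] at this
    exact (abs_le.1 this).2
  have hs1 : pk μ k w ≤ μ {x : ℕ → A | x 0 = x0 0} := by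
    apply measure_mono
    intro x hx
    have hx : Zk k x = w := hx
    have := congrFun (hx.trans hx0.symm) ⟨0, by omega⟩
    exact congrArg Prod.fst this
  have hs2 : pk μ k w ≤ μ {x : ℕ → A | x 0 = x0 l} := by
    have e : μ (shf l ⁻¹' {x : ℕ → A | x 0 = x0 l}) = μ {x : ℕ → A | x 0 = x0 l} :=
      (mp_shf hinv l).measure_preimage (hms _).nullMeasurableSet
    rw [← e]
    apply measure_mono
    intro x hx
    have hx : Zk k x = w := hx
    have h1 := congrArg Prod.fst (congrFun (hx.trans hx0.symm) ⟨1, by omega⟩)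
    have h2 := runStart_of_Zk (hx.trans hx0.symm) 1 (by omega)
    simp only [Zk, rle, h2] at h1
    change x (0 + l) = x0 l
    rw [zero_add]
    exact h1
  have hsum : μ {x : ℕ → A | x 0 = x0 0} + μ {x : ℕ → A | x 0 = x0 l} ≤ 1 := by
    rw [← measure_union _ (hms _)]
    · exact prob_le_one
    · rw [Set.disjoint_left]
      intro x h1 h2
      have h1 : x 0 = x0 0 := h1
      have h2 : x 0 = x0 l := h2
      exact hab (h2.symm.trans h1)
  have r1 := ENNReal.toReal_mono (measure_ne_top _ _) hs1
  have r2 := ENNReal.toReal_mono (measure_ne_top _ _) hs2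
  have r3 := ENNReal.toReal_mono ENNReal.one_ne_top hsum
  rw [ENNReal.toReal_add (measure_ne_top _ _) (measure_ne_top _ _), ENNReal.toReal_one] at r3
  have q1 := hq (x0 0)
  have q2 := hq (x0 l)
  set u := (μ {x : ℕ → A | x 0 = x0 0}).toReal
  set v := (μ {x : ℕ → A | x 0 = x0 l}).toReal
  set s := (pk μ k w).toReal
  refine ⟨by linarith, ?_⟩
  rcases le_total u (1 / 2) with hu | hu
  · nlinarith
  · have : v ≤ 1 / 2 := by linarith
    nlinarith

lemma P2_small (hinv : MeasurePreserving (shift (A := A)) μ μ) {c h : ℝ} (hA : HypA μ c h)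
    {a : ℕ → ℝ} (hmix : AlphaMixingBound μ a) {k : ℕ} (hk : 2 ≤ k) :
    (P2 μ k).toReal - (P2 μ k).toReal ^ 2 ≤ a 0 := by
  by_contra hcon
  push Not at hcon
  have hPtop : P2 μ k ≠ ⊤ := ((P2_le_one hinv k).trans_lt ENNReal.one_lt_top).ne
  have hlt : ∀ w, pk μ k w < P2 μ k := by
    intro w
    by_contra hw
    push Not at hw
    have h1 := ENNReal.toReal_mono (measure_ne_top _ _) hw
    change (P2 μ k).toReal ≤ (pk μ k w).toReal at h1
    obtain ⟨h2, h3⟩ := pk_small hinv hA hmix hk w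
    nlinarith
  have hex : ∃ w, pk μ k w ≠ 0 := by
    by_contra hno
    push Not at hno
    have := pk_sum (μ := μ) k
    simp [hno] at this
  obtain ⟨w0, hw0⟩ := hex
  have : P2 μ k < ∑' w, pk μ k w * P2 μ k := by
    refine ENNReal.tsum_lt_tsum (i := w0) hPtop (fun w => ?_) ?_
    · rw [sq]
      gcongr
      exact (hlt w).le
    · rw [sq]
      exact (ENNReal.mul_lt_mul_iff_right hw0 (measure_ne_top _ _)).2 (hlt w0)
  rw [ENNReal.tsum_mul_right, pk_sum, one_mul] at this
  exact lt_irrefl _ this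

lemma var_sum {X ι : Type*} [MeasurableSpace X] (ν : Measure X) [IsProbabilityMeasure ν]
    (s : Finset ι) (B : ι → Set X) (hB : ∀ r, MeasurableSet (B r)) :
    (∫ p, ∑ r ∈ s, (B r).indicator (fun _ => (1 : ℝ)) p ∂ν = ∑ r ∈ s, (ν (B r)).toReal) ∧
    ProbabilityTheory.variance (fun p => ∑ r ∈ s, (B r).indicator (fun _ => (1 : ℝ)) p) ν =
      (∑ r ∈ s, ∑ r' ∈ s, (ν (B r ∩ B r')).toReal) - (∑ r ∈ s, (ν (B r)).toReal) ^ 2 := by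
  have hi : ∀ C : Set X, MeasurableSet C → Integrable (C.indicator (fun _ => (1 : ℝ))) ν :=
    fun C hC => (integrable_const 1).indicator hC
  have he : ∫ p, ∑ r ∈ s, (B r).indicator (fun _ => (1 : ℝ)) p ∂ν
      = ∑ r ∈ s, (ν (B r)).toReal := by
    rw [integral_finsetSum _ fun r _ => hi _ (hB r)]
    refine Finset.sum_congr rfl fun r _ => ?_
    rw [integral_indicator (hB r)]
    simp [Measure.real]
  refine ⟨he, ?_⟩
  rw [ProbabilityTheory.variance_eq_sub, he]
  · congr 1
    have : ((fun p => ∑ r ∈ s, (B r).indicator (fun _ => (1 : ℝ)) p) ^ 2 : X → ℝ) =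
        fun p => ∑ r ∈ s, ∑ r' ∈ s, (B r ∩ B r').indicator (fun _ => (1 : ℝ)) p := by
      funext p
      simp only [Pi.pow_apply]
      rw [sq, Finset.sum_mul_sum]
      refine Finset.sum_congr rfl fun r _ => Finset.sum_congr rfl fun r' _ => ?_
      by_cases h1 : p ∈ B r <;> by_cases h2 : p ∈ B r' <;> simp [h1, h2]
    rw [this, integral_finsetSum _ fun r _ => integrable_finsetSum _ fun r' _ =>
      hi _ ((hB r).inter (hB r'))]
    refine Finset.sum_congr rfl fun r _ => ?_
    rw [integral_finsetSum _ fun r' _ => hi _ ((hB r).inter (hB r'))]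
    refine Finset.sum_congr rfl fun r' _ => ?_
    rw [integral_indicator ((hB r).inter (hB r'))]
    simp [Measure.real]
  · refine memLp_finsetSum _ fun r _ => ?_
    exact (memLp_const (1 : ℝ)).indicator (hB r)

lemma Sn_eq (k n : ℕ) : Sn (A := A) k n = fun p =>
    ∑ r ∈ Finset.range n ×ˢ Finset.range n, (Aev k r).indicator (fun _ => (1 : ℝ)) p := by
  classical
  funext p
  rw [Finset.sum_product]
  unfold Sn
  refine Finset.sum_congr rfl fun i _ => Finset.sum_congr rfl fun j _ => ?_
  rw [Set.indicator_apply]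
  refine if_congr ?_ rfl rfl
  change _ ↔ Zk k (shf i p.1) = Zk k (shf j p.2)
  constructor
  · intro h
    funext m
    exact h m m.2
  · intro h m hm
    exact congrFun h ⟨m, hm⟩

/-- closeness indicator -/
noncomputable def cl (N i i' : ℕ) : ℝ := if i + N ≤ i' ∨ i' + N ≤ i then 0 else 1

lemma cl_nonneg (N i i' : ℕ) : 0 ≤ cl N i i' := by
  unfold cl
  split_ifs <;> norm_num

lemma cl_sum (N i n : ℕ) : ∑ i' ∈ Finset.range n, cl N i i' ≤ 2 * N := by
  unfold cl
  have : ∀ i', (if i + N ≤ i' ∨ i' + N ≤ i then (0 : ℝ) else 1) =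
      if ¬ (i + N ≤ i' ∨ i' + N ≤ i) then 1 else 0 := by
    intro i'
    split_ifs <;> simp_all
  simp_rw [this]
  rw [Finset.sum_boole]
  have h : ((Finset.range n).filter fun i' => ¬ (i + N ≤ i' ∨ i' + N ≤ i)).card ≤ 2 * N := by
    calc _ ≤ (Finset.Ico (i + 1 - N) (i + N)).card := by
          apply Finset.card_le_card
          intro t ht
          simp only [Finset.mem_filter, Finset.mem_range, Finset.mem_Ico] at ht ⊢
          omega
      _ ≤ 2 * N := by
          rw [Nat.card_Ico]
          omega
  exact_mod_cast h

lemma sum_bound (N n : ℕ) (r : ℕ × ℕ) {e B P : ℝ} (hB : 0 ≤ B) (hP : 0 ≤ P) :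
    ∑ r' ∈ Finset.range n ×ˢ Finset.range n,
      (e + (cl N r.1 r'.1 + cl N r.2 r'.2) * B + cl N r.1 r'.1 * cl N r.2 r'.2 * P) ≤
    (n : ℝ) ^ 2 * e + 4 * N * n * B + 4 * (N : ℝ) ^ 2 * P := by
  have hF := cl_sum N r.1 n
  have hG := cl_sum N r.2 n
  have hF0 : 0 ≤ ∑ i' ∈ Finset.range n, cl N r.1 i' := Finset.sum_nonneg fun _ _ => cl_nonneg _ _ _
  have hG0 : 0 ≤ ∑ i' ∈ Finset.range n, cl N r.2 i' := Finset.sum_nonneg fun _ _ => cl_nonneg _ _ _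
  have e1 : ∑ r' ∈ Finset.range n ×ˢ Finset.range n,
      (e + (cl N r.1 r'.1 + cl N r.2 r'.2) * B + cl N r.1 r'.1 * cl N r.2 r'.2 * P) =
      (n : ℝ) ^ 2 * e + (n * (∑ i' ∈ Finset.range n, cl N r.1 i')
        + n * (∑ i' ∈ Finset.range n, cl N r.2 i')) * B
      + (∑ i' ∈ Finset.range n, cl N r.1 i') * (∑ i' ∈ Finset.range n, cl N r.2 i') * P := by
    rw [Finset.sum_mul_sum, Finset.sum_add_distrib, Finset.sum_add_distrib, ← Finset.sum_mul,
      ← Finset.sum_mul, Finset.sum_add_distrib]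
    simp only [Finset.sum_product, Finset.sum_const, Finset.card_product, Finset.card_range,
      nsmul_eq_mul, Nat.cast_mul,
      Finset.mul_sum]
    ring
  rw [e1]
  have hn : (0 : ℝ) ≤ n := Nat.cast_nonneg n
  have h1 := mul_le_mul_of_nonneg_left hF hn
  have h2 := mul_le_mul_of_nonneg_left hG hn
  have h3 := mul_le_mul hF hG hG0 (by positivity)
  have h4 := mul_le_mul_of_nonneg_right (add_le_add h1 h2) hB
  have h5 := mul_le_mul_of_nonneg_right h3 hP
  nlinarith

lemma cov_bound (hinv : MeasurePreserving (shift (A := A)) μ μ) {c h : ℝ} (hA : HypA μ c h)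
    {a : ℕ → ℝ} (ha : Antitone a) (hmix : AlphaMixingBound μ a) (k N : ℕ) (hN : k ^ 3 ≤ N)
    (ε P : ℝ) (hε : ε = a (N - k ^ 3) + c * Real.exp (-h * (k : ℝ) ^ 2))
    (hP : P = (P2 μ k).toReal) (r r' : ℕ × ℕ) :
    ((μ.prod μ) (Aev k r ∩ Aev k r')).toReal ≤ P ^ 2 + (2 * ε +
      (cl N r.1 r'.1 + cl N r.2 r'.2) * (P ^ (3 / 2 : ℝ) + ε)
      + cl N r.1 r'.1 * cl N r.2 r'.2 * P) := by
  have hPtop : P2 μ k ≠ ⊤ := ((P2_le_one hinv k).trans_lt ENNReal.one_lt_top).ne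
  have h0 := a_nonneg hmix (N - k ^ 3)
  have h1 : 0 ≤ c * Real.exp (-h * (k : ℝ) ^ 2) := mul_nonneg hA.1.le (Real.exp_pos _).le
  have hε0 : 0 ≤ ε := by rw [hε]; linarith
  have hP0 : 0 ≤ P := by rw [hP]; exact ENNReal.toReal_nonneg
  have hT0 : 0 ≤ P ^ (3 / 2 : ℝ) := Real.rpow_nonneg hP0 _
  have hP2 : P2 μ k = ENNReal.ofReal P := by rw [hP, ENNReal.ofReal_toReal hPtop]
  have hq : ∀ i i', (i + N ≤ i' ∨ i' + N ≤ i) → ∀ w, qk μ k i i' w ≤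
      pk μ k w.1 * pk μ k w.2 + ENNReal.ofReal ε := by
    intro i i' hi w
    rw [hε]
    exact qk_le hinv hA ha hmix k N i i' hN hi w
  have conv1 : ∀ {J : ENNReal}, J ≤ P2 μ k ^ (3 / 2 : ℝ) + ENNReal.ofReal ε →
      J.toReal ≤ P ^ (3 / 2 : ℝ) + ε := by
    intro J hJ
    rw [hP2, ENNReal.ofReal_rpow_of_nonneg hP0 (by norm_num), ← ENNReal.ofReal_add hT0 hε0] at hJ
    exact ENNReal.toReal_le_of_le_ofReal (by positivity) hJ
  by_cases c1 : r.1 + N ≤ r'.1 ∨ r'.1 + N ≤ r.1 <;> by_cases c2 : r.2 + N ≤ r'.2 ∨ r'.2 + N ≤ r.2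
  · have := far_far (hq _ _ c1) (hq _ _ c2)
    rw [← prob_Aev2, hP2, ← ENNReal.ofReal_mul hP0,
      show (2 : ENNReal) = ENNReal.ofReal 2 by simp, ← ENNReal.ofReal_mul (by norm_num),
      ← ENNReal.ofReal_add (by positivity) (by positivity)] at this
    have := ENNReal.toReal_le_of_le_ofReal (by positivity) this
    simp only [cl, if_pos c1, if_pos c2]
    nlinarith
  · have h2 := close_far (i := r.2) (i' := r'.2) hinv (hq _ _ c1)
    simp_rw [mul_comm (qk μ k r.2 r'.2 _)] at h2
    rw [← prob_Aev2] at h2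
    have := conv1 h2
    simp only [cl, if_pos c1, if_neg c2]
    nlinarith
  · have h2 := close_far (i := r.1) (i' := r'.1) hinv (hq _ _ c2)
    rw [← prob_Aev2] at h2
    have := conv1 h2
    simp only [cl, if_pos c2, if_neg c1]
    nlinarith
  · have h2 : (μ.prod μ) (Aev k r ∩ Aev k r') ≤ P2 μ k := by
      rw [← prob_Aev hinv k r]
      exact measure_mono Set.inter_subset_left
    have := ENNReal.toReal_mono hPtop h2
    rw [← hP] at this
    simp only [cl, if_neg c2, if_neg c1]
    nlinarith

end Meas
end Aux

/-- Lemma `lemvar`: variance bound for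
`S_n = Σ_{0 ≤ i,j ≤ n-1} 1_{A_{i,j}}`, with `X, Y` independent copies of the stationary
process (modelled as the two coordinates of the product space with measure `μ ⊗ μ`):
`var(S_n) ≤ 4(g+k)E(S_n)^{3/2} + 4(g+k)²E(S_n) + 2n⁴α(g+k-k³)
  + 4n³(g+k)α(g+k-k³) + (2n⁴+4n³(g+k)) c e^{-hk²}`. -/
theorem stmt6 {A : Type*} [Fintype A] [MeasurableSpace A] [MeasurableSingletonClass A]
    (μ : Measure (ℕ → A)) [IsProbabilityMeasure μ]
    (hinv : MeasurePreserving (shift (A := A)) μ μ)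
    (c h : ℝ) (hA : HypA μ c h)
    (a : ℕ → ℝ) (ha : Antitone a) (hmix : AlphaMixingBound μ a)
    (k g n : ℕ) :
    ProbabilityTheory.variance (Sn k n) (μ.prod μ) ≤
      4 * ((g : ℝ) + k) * (∫ p, Sn k n p ∂(μ.prod μ)) ^ (3 / 2 : ℝ)
      + 4 * ((g : ℝ) + k) ^ 2 * (∫ p, Sn k n p ∂(μ.prod μ))
      + 2 * (n : ℝ) ^ 4 * a (g + k - k ^ 3)
      + 4 * (n : ℝ) ^ 3 * ((g : ℝ) + k) * a (g + k - k ^ 3)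
      + (2 * (n : ℝ) ^ 4 + 4 * (n : ℝ) ^ 3 * ((g : ℝ) + k)) * c *
          Real.exp (-h * (k : ℝ) ^ 2) := by
  have hPtop : P2 μ k ≠ ⊤ := ((P2_le_one hinv k).trans_lt ENNReal.one_lt_top).ne
  obtain ⟨hE, hV⟩ := var_sum (μ.prod μ) (Finset.range n ×ˢ Finset.range n) (Aev (A := A) k)
    (meas_Aev k)
  have hP0 : 0 ≤ (P2 μ k).toReal := ENNReal.toReal_nonneg
  have hce : 0 ≤ c * Real.exp (-h * (k : ℝ) ^ 2) := mul_nonneg hA.1.le (Real.exp_pos _).le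
  have ha0 := a_nonneg hmix (g + k - k ^ 3)
  obtain ⟨P, hP⟩ : ∃ P, P = (P2 μ k).toReal := ⟨_, rfl⟩
  have hsum : ∑ r ∈ Finset.range n ×ˢ Finset.range n, ((μ.prod μ) (Aev (A := A) k r)).toReal
      = (n : ℝ) ^ 2 * P := by
    simp_rw [prob_Aev hinv, ← hP]
    simp [sq]
  rw [← hP] at hP0
  rw [Sn_eq, hV, hE, hsum]
  have hn : (0 : ℝ) ≤ n := Nat.cast_nonneg n
  have hT0 : 0 ≤ P ^ (3 / 2 : ℝ) := Real.rpow_nonneg hP0 _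
  have hT : ((n : ℝ) ^ 2 * P) ^ (3 / 2 : ℝ) = (n : ℝ) ^ 3 * P ^ (3 / 2 : ℝ) := by
    rw [Real.mul_rpow (by positivity) hP0]
    congr 1
    rw [← Real.rpow_natCast (n : ℝ) 2, ← Real.rpow_mul hn, ← Real.rpow_natCast (n : ℝ) 3]
    norm_num
  rw [hT]
  by_cases hN : k ^ 3 ≤ g + k
  · obtain ⟨ε, hε⟩ : ∃ ε, ε = a (g + k - k ^ 3) + c * Real.exp (-h * (k : ℝ) ^ 2) := ⟨_, rfl⟩
    have hε0 : 0 ≤ ε := by rw [hε]; linarith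
    have hcov := cov_bound hinv hA ha hmix k (g + k) hN ε P hε hP
    have hin : ∀ r ∈ Finset.range n ×ˢ Finset.range n,
        ∑ r' ∈ Finset.range n ×ˢ Finset.range n, ((μ.prod μ) (Aev (A := A) k r ∩ Aev k r')).toReal
        ≤ (n : ℝ) ^ 2 * P ^ 2 + ((n : ℝ) ^ 2 * (2 * ε) + 4 * (g + k : ℕ) * n *
          (P ^ (3 / 2 : ℝ) + ε) + 4 * ((g + k : ℕ) : ℝ) ^ 2 * P) := by
      intro r _
      refine (Finset.sum_le_sum fun r' _ => hcov r r').trans ?_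
      rw [Finset.sum_add_distrib]
      refine add_le_add (le_of_eq ?_) (sum_bound (g + k) n r (by positivity) hP0)
      simp [sq]
    have htot := Finset.sum_le_sum hin
    rw [Finset.sum_const, Finset.card_product, Finset.card_range, nsmul_eq_mul] at htot
    push_cast at htot
    have hεeq : a (g + k - k ^ 3) = ε - c * Real.exp (-h * (k : ℝ) ^ 2) := by rw [hε]; ring
    rw [hεeq]
    nlinarith
  · have hk : 2 ≤ k := by
      by_contra hk
      apply hN
      have : k = 0 ∨ k = 1 := by omega
      rcases this with rfl | rfl <;> simp
    have hsm := P2_small hinv hA hmix hk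
    rw [← hP] at hsm
    rw [show g + k - k ^ 3 = 0 by omega] at ha0 ⊢
    have hin : ∑ r ∈ Finset.range n ×ˢ Finset.range n,
        ∑ r' ∈ Finset.range n ×ˢ Finset.range n, ((μ.prod μ) (Aev (A := A) k r ∩ Aev k r')).toReal
        ≤ ∑ r ∈ Finset.range n ×ˢ Finset.range n, ∑ r' ∈ Finset.range n ×ˢ Finset.range n, P := by
      refine Finset.sum_le_sum fun r _ => Finset.sum_le_sum fun r' _ => ?_
      rw [hP]
      refine ENNReal.toReal_mono hPtop ?_
      rw [← prob_Aev hinv k r]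
      exact measure_mono Set.inter_subset_left
    simp only [Finset.sum_const, Finset.card_product, Finset.card_range, nsmul_eq_mul] at hin
    push_cast at hin
    have h4 : (n : ℝ) ^ 4 * (P - P ^ 2) ≤ (n : ℝ) ^ 4 * a 0 :=
      mul_le_mul_of_nonneg_left hsm (by positivity)
    have p1 : 0 ≤ 4 * ((g : ℝ) + k) * ((n : ℝ) ^ 3 * P ^ (3 / 2 : ℝ)) := by positivity
    have p2 : 0 ≤ 4 * ((g : ℝ) + k) ^ 2 * ((n : ℝ) ^ 2 * P) := by positivity
    have p3 : 0 ≤ 4 * (n : ℝ) ^ 3 * ((g : ℝ) + k) * a 0 := by positivity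
    have p4 : 0 ≤ (2 * (n : ℝ) ^ 4 + 4 * (n : ℝ) ^ 3 * ((g : ℝ) + k)) * c *
          Real.exp (-h * (k : ℝ) ^ 2) := by
      rw [mul_assoc]
      positivity
    have p5 : 0 ≤ (n : ℝ) ^ 4 * a 0 := by positivity
    have p6 : (n : ℝ) * n * (n * n * P) - ((n : ℝ) ^ 2 * P) ^ 2 = (n : ℝ) ^ 4 * (P - P ^ 2) := by
      ring
    linarith
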